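/- Let μ ∈ ℝ^n and ν ∈ ℝ^m be probability vectors with strictly positive entries summing to 1, and let π₁ be a real n×m matrix with strictly positive entries. Define the Sinkhorn iterates by π_{2t}(i,j) = π_{2t−1}(i,j)·ν(j)/(Σ_{i'} π_{2t−1}(i',j)) and π_{2t+1}(i,j) = π_{2t}(i,j)·μ(i)/(Σ_{j'} π_{2t}(i,j')). For each t let μ_t ∈ ℝ^n be the vector of row sums of π_t and ν_t ∈ ℝ^m the vector of column sums of π_t. Then there exists a constant C > 0 such that for all t ≥ 1: H(μ_t | μ) + H(μ | μ_t) + H(ν_t | ν) + H(ν | ν_t) ≤ C/t², where H(p|q) = Σ_i p_i·log(p_i/q_i). In particular the marginals of the Sinkhorn iterates converge to the prescribed marginals at rate O(t^{−2}) in symmetrized KL divergence, faster than the O(t^{−1}) rate of the plans themselves. -/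

import Mathlib

theorem exists_pos_forall_le_of_finite {ι : Type*} [Finite ι] (f : ι → ℝ) (hf : ∀ i, 0 < f i) :
    ∃ c : ℝ, 0 < c ∧ ∀ i, c ≤ f i := by
  rcases isEmpty_or_nonempty ι with h | h
  · exact ⟨1, one_pos, fun i => h.elim i⟩
  · obtain ⟨i, hi⟩ := Finite.exists_min f
    exact ⟨f i, hf i, hi⟩

theorem weighted_sum_le_sub_mul {ι : Type*} [Fintype ι] {w r : ι → ℝ} {b δ : ℝ} (i₀ : ι)
    (hw : ∀ i, 0 ≤ w i) (hw1 : ∑ i, w i = 1) (hδ : δ ≤ w i₀) (hr : ∀ i, r i ≤ b) :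
    ∑ i, w i * r i ≤ b - δ * (b - r i₀) := by
  have h1 : w i₀ * (b - r i₀) ≤ ∑ i, w i * (b - r i) :=
    Finset.single_le_sum (f := fun i => w i * (b - r i))
      (fun i _ => mul_nonneg (hw i) (sub_nonneg.2 (hr i))) (Finset.mem_univ i₀)
  have h2 : ∑ i, w i * (b - r i) = b - ∑ i, w i * r i := by
    simp only [mul_sub, Finset.sum_sub_distrib, ← Finset.sum_mul, hw1, one_mul]
  have h3 := mul_le_mul_of_nonneg_right hδ (sub_nonneg.2 (hr i₀))
  linarith

theorem add_mul_le_weighted_sum {ι : Type*} [Fintype ι] {w r : ι → ℝ} {a δ : ℝ} (i₀ : ι)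
    (hw : ∀ i, 0 ≤ w i) (hw1 : ∑ i, w i = 1) (hδ : δ ≤ w i₀) (hr : ∀ i, a ≤ r i) :
    a + δ * (r i₀ - a) ≤ ∑ i, w i * r i := by
  have h := weighted_sum_le_sub_mul (r := fun i => -r i) (b := -a) i₀ hw hw1 hδ
    (fun i => neg_le_neg (hr i))
  simp only [mul_neg, Finset.sum_neg_distrib] at h
  linarith

/-- A positive matrix with column sums `ν`, cross-ratios at least `κ`, and row scaling factors
`μ i / ∑ j, A i j` that lie in `[K⁻¹, K]` and in an interval of relative length at most `E`. -/
structure IsScaled {α β : Type*} [Fintype α] [Fintype β] (μ : α → ℝ) (ν : β → ℝ) (κ K E : ℝ)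
    (A : Matrix α β ℝ) : Prop where
  pos : ∀ i j, 0 < A i j
  col : ∀ j, ∑ i, A i j = ν j
  cross : ∀ i j k l, κ * (A i l * A k j) ≤ A i j * A k l
  ratio : ∃ a b : ℝ, K⁻¹ ≤ a ∧ b ≤ K ∧ b - a ≤ E * a ∧
    ∀ i, a ≤ μ i / ∑ j, A i j ∧ μ i / ∑ j, A i j ≤ b

section

variable {α β : Type*} [Fintype α] [Fintype β] {μ : α → ℝ} {ν : β → ℝ} {κ K E : ℝ}
  {A : Matrix α β ℝ}

theorem IsScaled.mul_rowSum_le (h : IsScaled μ ν κ K E A) (hν1 : ∑ j, ν j = 1) (i : α) (j : β) :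
    κ * ((∑ l, A i l) * ν j) ≤ A i j := by
  have htot : ∑ l, ∑ k, A k l = 1 := by simp only [h.col, hν1]
  calc κ * ((∑ l, A i l) * ν j) = ∑ l, ∑ k, κ * (A i l * A k j) := by
        simp only [← h.col j, Finset.sum_mul, Finset.mul_sum]
        exact Finset.sum_comm
    _ ≤ ∑ l, ∑ k, A i j * A k l :=
        Finset.sum_le_sum fun l _ => Finset.sum_le_sum fun k _ => h.cross i j k l
    _ = A i j := by simp only [← Finset.mul_sum, htot, mul_one]

theorem IsScaled.rowSum_pos [Nonempty β] (h : IsScaled μ ν κ K E A) (i : α) :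
    0 < ∑ j, A i j :=
  Finset.sum_pos (fun j _ => h.pos i j) Finset.univ_nonempty

/-- Rescaling the rows contracts the relative length of the interval of scaling factors. -/
theorem IsScaled.rowRescale [Nonempty α] [Nonempty β] {δ c : ℝ} (h : IsScaled μ ν κ K E A)
    (hμ : ∀ i, 0 < μ i) (hν : ∀ j, 0 < ν j) (hν1 : ∑ j, ν j = 1)
    (hκ : 0 ≤ κ) (hK : 0 < K) (hE : 0 ≤ E) (hδ0 : 0 ≤ δ) (hδ1 : δ ≤ 1)
    (hc : ∀ i, c ≤ μ i) (hδ : δ * K ≤ κ * c) {B : Matrix α β ℝ}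
    (hB : ∀ i j, B i j = A i j * μ i / ∑ j', A i j') :
    IsScaled ν μ κ K (E * (1 - δ)) B.transpose := by
  have hs := h.rowSum_pos
  have hBpos : ∀ i j, 0 < B i j := fun i j => by
    rw [hB]; exact div_pos (mul_pos (h.pos i j) (hμ i)) (hs i)
  obtain ⟨a, b, ha, hb, hab, hr⟩ := h.ratio
  have ha0 : 0 < a := (inv_pos.2 hK).trans_le ha
  obtain ⟨i₀⟩ := ‹Nonempty α›
  set r : α → ℝ := fun i => μ i / ∑ j, A i j with hrdef
  have hr0 : ∀ i, 0 < r i := fun i => div_pos (hμ i) (hs i)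
  have hBr : ∀ i j, B i j = A i j * r i := fun i j => by rw [hB, mul_div_assoc]
  refine ⟨fun j i => hBpos i j, fun i => ?_, fun j i l k => ?_, ?_⟩
  · simp only [Matrix.transpose_apply, hBr, ← Finset.sum_mul]
    exact mul_div_cancel₀ _ (hs i).ne'
  · simp only [Matrix.transpose_apply, hBr]
    have := mul_le_mul_of_nonneg_right (h.cross i j k l) (mul_pos (hr0 i) (hr0 k)).le
    linarith
  · have hw : ∀ j i, δ ≤ A i j / ν j := fun j i => by
      rw [le_div_iff₀ (hν j)]
      refine le_trans ?_ (h.mul_rowSum_le hν1 i j)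
      rw [← mul_assoc]
      refine mul_le_mul_of_nonneg_right ?_ (hν j).le
      have h1 : μ i ≤ K * ∑ l, A i l := by
        have := (hr i).2.trans hb
        rwa [div_le_iff₀ (hs i)] at this
      have h2 : κ * c ≤ κ * (K * ∑ l, A i l) := mul_le_mul_of_nonneg_left ((hc i).trans h1) hκ
      have h3 : δ * K ≤ (κ * ∑ l, A i l) * K := by linarith
      exact le_of_mul_le_mul_right h3 hK
    have hw0 : ∀ j i, 0 ≤ A i j / ν j := fun j i => (div_pos (h.pos i j) (hν j)).le
    have hw1 : ∀ j, ∑ i, A i j / ν j = 1 := fun j => by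
      rw [← Finset.sum_div, h.col, div_self (hν j).ne']
    have hsum : ∀ j, ν j / ∑ i, B.transpose j i = (∑ i, A i j / ν j * r i)⁻¹ := fun j => by
      have : ∑ i, A i j / ν j * r i = (∑ i, B.transpose j i) / ν j := by
        rw [Finset.sum_div]
        refine Finset.sum_congr rfl fun i _ => ?_
        rw [Matrix.transpose_apply, hBr]; ring
      rw [this, inv_div]
    have hup := fun j => weighted_sum_le_sub_mul i₀ (hw0 j) (hw1 j) (hw j i₀) (fun i => (hr i).2)
    have hlo := fun j => add_mul_le_weighted_sum i₀ (hw0 j) (hw1 j) (hw j i₀) (fun i => (hr i).1)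
    set M' := b - δ * (b - r i₀) with hM'
    set m' := a + δ * (r i₀ - a) with hm'
    have hm'a : a ≤ m' := le_add_of_nonneg_right (mul_nonneg hδ0 (sub_nonneg.2 (hr i₀).1))
    have hM'b : M' ≤ b := sub_le_self _ (mul_nonneg hδ0 (sub_nonneg.2 (hr i₀).2))
    have hm'0 : 0 < m' := ha0.trans_le hm'a
    have hM'0 : 0 < M' := by
      obtain ⟨j₀⟩ := ‹Nonempty β›
      exact hm'0.trans_le ((hlo j₀).trans (hup j₀))
    refine ⟨M'⁻¹, m'⁻¹, inv_anti₀ hM'0 (hM'b.trans hb), ?_, ?_, fun j => ?_⟩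
    · exact inv_le_of_inv_le₀ hK (ha.trans hm'a)
    · have h1 : M' - m' ≤ E * (1 - δ) * m' := by
        have e1 : M' - m' = (1 - δ) * (b - a) := by rw [hM', hm']; ring
        have h2 := mul_le_mul_of_nonneg_left hab (sub_nonneg.2 hδ1)
        have h3 := mul_le_mul_of_nonneg_left hm'a (mul_nonneg hE (sub_nonneg.2 hδ1))
        linarith
      have e2 : m'⁻¹ - M'⁻¹ = (M' - m') / m' * M'⁻¹ := by field_simp
      rw [e2]
      exact mul_le_mul_of_nonneg_right ((div_le_iff₀ hm'0).2 h1) (inv_pos.2 hM'0).le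
    · rw [hsum]
      have hpos := hm'0.trans_le (hlo j)
      exact ⟨inv_anti₀ hpos (hup j), inv_anti₀ hm'0 (hlo j)⟩

theorem IsScaled.symm_kl_le [Nonempty α] [Nonempty β] (h : IsScaled μ ν κ K E A)
    (hμ : ∀ i, 0 < μ i) (hμ1 : ∑ i, μ i = 1) (hν1 : ∑ j, ν j = 1) (hK : 0 < K) (hE : 0 ≤ E) :
    (∑ i, (∑ j, A i j) * Real.log ((∑ j, A i j) / μ i))
      + (∑ i, μ i * Real.log (μ i / ∑ j, A i j)) ≤ E * (K ^ 2 + K) := by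
  have hs := h.rowSum_pos
  have htot : ∑ i, ∑ j, A i j = 1 :=
    Finset.sum_comm.trans (by simp only [h.col, hν1])
  obtain ⟨a, b, ha, hb, hab, hr⟩ := h.ratio
  have hlo : ∀ i, a * ∑ j, A i j ≤ μ i := fun i => (le_div_iff₀ (hs i)).1 (hr i).1
  have hup : ∀ i, μ i ≤ b * ∑ j, A i j := fun i => (div_le_iff₀ (hs i)).1 (hr i).2
  have ha1 : a ≤ 1 := by
    have := Finset.sum_le_sum fun i (_ : i ∈ Finset.univ) => hlo i
    rwa [← Finset.mul_sum, htot, hμ1, mul_one] at this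
  have hb1 : 1 ≤ b := by
    have := Finset.sum_le_sum fun i (_ : i ∈ Finset.univ) => hup i
    rwa [← Finset.mul_sum, htot, hμ1, mul_one] at this
  have hEK : b - a ≤ E * K :=
    hab.trans (mul_le_mul_of_nonneg_left (ha1.trans (hb1.trans hb)) hE)
  have hEK0 : 0 ≤ E * K := mul_nonneg hE hK.le
  have h1 : ∀ i, (∑ j, A i j) * Real.log ((∑ j, A i j) / μ i) ≤ (∑ j, A i j) * (E * K ^ 2) :=
    fun i => by
      refine mul_le_mul_of_nonneg_left ?_ (hs i).le
      refine (Real.log_le_sub_one_of_pos (div_pos (hs i) (hμ i))).trans ?_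
      have hri : (∑ j, A i j) / μ i ≤ K := by
        rw [← inv_div]
        exact inv_le_of_inv_le₀ hK (ha.trans (hr i).1)
      have hr1 : 1 - μ i / ∑ j, A i j ≤ E * K := by linarith [(hr i).1]
      have hq : 0 < (∑ j, A i j) / μ i := div_pos (hs i) (hμ i)
      calc (∑ j, A i j) / μ i - 1
          = (∑ j, A i j) / μ i * (1 - μ i / ∑ j, A i j) := by
            have := (hs i).ne'
            have := (hμ i).ne'
            field_simp
        _ ≤ (∑ j, A i j) / μ i * (E * K) := mul_le_mul_of_nonneg_left hr1 hq.le
        _ ≤ K * (E * K) := mul_le_mul_of_nonneg_right hri hEK0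
        _ = E * K ^ 2 := by ring
  have h2 : ∀ i, μ i * Real.log (μ i / ∑ j, A i j) ≤ μ i * (E * K) := fun i => by
    refine mul_le_mul_of_nonneg_left ?_ (hμ i).le
    refine (Real.log_le_sub_one_of_pos (div_pos (hμ i) (hs i))).trans ?_
    linarith [(hr i).2]
  have h3 := Finset.sum_le_sum fun i (_ : i ∈ Finset.univ) => h1 i
  have h4 := Finset.sum_le_sum fun i (_ : i ∈ Finset.univ) => h2 i
  rw [← Finset.sum_mul, htot] at h3
  rw [← Finset.sum_mul, hμ1] at h4
  linarith

theorem IsScaled.sum_col_log_eq_zero (h : IsScaled μ ν κ K E A) (hν : ∀ j, 0 < ν j) :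
    (∑ j, (∑ i, A i j) * Real.log ((∑ i, A i j) / ν j))
      + (∑ j, ν j * Real.log (ν j / ∑ i, A i j)) = 0 := by
  simp [h.col, fun j => div_self (hν j).ne']

theorem IsScaled.exists_of_pos [Nonempty β] (hA : ∀ i j, 0 < A i j)
    (hcol : ∀ j, ∑ i, A i j = ν j) (hμ : ∀ i, 0 < μ i) :
    ∃ κ K E : ℝ, 0 < κ ∧ 0 < K ∧ 0 ≤ E ∧ IsScaled μ ν κ K E A := by
  have hs : ∀ i, 0 < ∑ j, A i j := fun i =>
    Finset.sum_pos (fun j _ => hA i j) Finset.univ_nonempty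
  obtain ⟨κ, hκ, hκ'⟩ := exists_pos_forall_le_of_finite
    (fun p : α × β × α × β => A p.1 p.2.1 * A p.2.2.1 p.2.2.2 / (A p.1 p.2.2.2 * A p.2.2.1 p.2.1))
    (fun _ => div_pos (mul_pos (hA _ _) (hA _ _)) (mul_pos (hA _ _) (hA _ _)))
  obtain ⟨c, hc, hc'⟩ := exists_pos_forall_le_of_finite (fun i => μ i / ∑ j, A i j)
    (fun i => div_pos (hμ i) (hs i))
  obtain ⟨d, hd, hd'⟩ := exists_pos_forall_le_of_finite (fun i => (μ i / ∑ j, A i j)⁻¹)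
    (fun i => inv_pos.2 (div_pos (hμ i) (hs i)))
  have hk : 0 < min c d := lt_min hc hd
  refine ⟨κ, (min c d)⁻¹, (min c d)⁻¹ * (min c d)⁻¹, hκ, inv_pos.2 hk, by positivity, hA, hcol,
    fun i j k l => ?_, min c d, (min c d)⁻¹, (inv_inv _).le, le_rfl, ?_, fun i => ⟨?_, ?_⟩⟩
  · exact (le_div_iff₀ (mul_pos (hA _ _) (hA _ _))).1 (hκ' (i, j, k, l))
  · rw [mul_assoc, inv_mul_cancel₀ hk.ne', mul_one]
    linarith
  · exact (min_le_left _ _).trans (hc' i)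
  · exact le_inv_of_le_inv₀ hk ((min_le_right _ _).trans (hd' i))

end

theorem exists_forall_sq_mul_pow_le {ρ : ℝ} (h0 : 0 ≤ ρ) (h1 : ρ < 1) :
    ∃ D : ℝ, ∀ t : ℕ, (t : ℝ) ^ 2 * ρ ^ t ≤ D := by
  obtain ⟨D, hD⟩ := (tendsto_pow_const_mul_const_pow_of_lt_one 2 h0 h1).bddAbove_range
  exact ⟨D, fun t => hD ⟨t, rfl⟩⟩

/-- **Marginals of Sinkhorn iterates converge at rate `O(t⁻²)` in symmetrized KL.**
For positive probability vectors `μ, ν` and a positive initial matrix, the row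
and column marginals `μ_t, ν_t` of the Sinkhorn iterates satisfy
`H(μ_t | μ) + H(μ | μ_t) + H(ν_t | ν) + H(ν | ν_t) ≤ C/t²`. -/
theorem sinkhorn_marginal_convergence_rate {n m : ℕ} (hn : 0 < n) (hm : 0 < m)
    (μ : Fin n → ℝ) (ν : Fin m → ℝ)
    (hμ : ∀ i, 0 < μ i) (hν : ∀ j, 0 < ν j)
    (hμsum : ∑ i, μ i = 1) (hνsum : ∑ j, ν j = 1)
    (π : ℕ → Matrix (Fin n) (Fin m) ℝ)
    (hπ1 : ∀ i j, 0 < π 1 i j)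
    (heven : ∀ t : ℕ, 1 ≤ t → ∀ i j,
      π (2 * t) i j = π (2 * t - 1) i j * ν j / ∑ i', π (2 * t - 1) i' j)
    (hodd : ∀ t : ℕ, 1 ≤ t → ∀ i j,
      π (2 * t + 1) i j = π (2 * t) i j * μ i / ∑ j', π (2 * t) i j')
    (μt : ℕ → Fin n → ℝ) (νt : ℕ → Fin m → ℝ)
    (hμt : ∀ t i, μt t i = ∑ j, π t i j)
    (hνt : ∀ t j, νt t j = ∑ i, π t i j) :
    ∃ C : ℝ, 0 < C ∧
      ∀ t : ℕ, 1 ≤ t →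
        (∑ i, μt t i * Real.log (μt t i / μ i))
          + (∑ i, μ i * Real.log (μ i / μt t i))
          + (∑ j, νt t j * Real.log (νt t j / ν j))
          + (∑ j, ν j * Real.log (ν j / νt t j)) ≤ C / (t : ℝ) ^ 2 := by
  have : NeZero n := ⟨hn.ne'⟩
  have : NeZero m := ⟨hm.ne'⟩
  have hcol2 : ∀ j, 0 < ∑ i', π 1 i' j := fun j =>
    Finset.sum_pos (fun i _ => hπ1 i j) Finset.univ_nonempty
  have h2 : ∀ i j, π 2 i j = π 1 i j * ν j / ∑ i', π 1 i' j := heven 1 le_rfl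
  obtain ⟨κ, K, E, hκ, hK, hE, hS⟩ := IsScaled.exists_of_pos (A := π 2) (ν := ν) (μ := μ)
    (fun i j => by rw [h2]; exact div_pos (mul_pos (hπ1 i j) (hν j)) (hcol2 j))
    (fun j => by
      simp only [h2]
      rw [← Finset.sum_div, ← Finset.sum_mul, mul_div_cancel_left₀ _ (hcol2 j).ne'])
    hμ
  obtain ⟨c₁, hc₁, hc₁'⟩ := exists_pos_forall_le_of_finite μ hμ
  obtain ⟨c₂, hc₂, hc₂'⟩ := exists_pos_forall_le_of_finite ν hν
  have hc : 0 < min c₁ c₂ := lt_min hc₁ hc₂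
  obtain ⟨δ, hδ0, hδ1, hδ⟩ : ∃ δ : ℝ, 0 < δ ∧ δ < 1 ∧ δ * K ≤ κ * min c₁ c₂ :=
    ⟨min (1 / 2) (κ * min c₁ c₂ / K), lt_min (by norm_num) (by positivity),
      (min_le_left _ _).trans_lt (by norm_num), (le_div_iff₀ hK).1 (min_le_right _ _)⟩
  have hρ0 : 0 < 1 - δ := sub_pos.2 hδ1
  have hEρ : ∀ k : ℕ, 0 ≤ E * (1 - δ) ^ k := fun k => by positivity
  have rowStep : ∀ s : ℕ, IsScaled μ ν κ K (E * (1 - δ) ^ (2 * s)) (π (2 * (s + 1))) →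
      IsScaled ν μ κ K (E * (1 - δ) ^ (2 * s + 1)) (π (2 * (s + 1) + 1)).transpose := by
    intro s hs
    rw [pow_succ, ← mul_assoc]
    exact hs.rowRescale hμ hν hνsum hκ.le hK (hEρ _) hδ0.le hδ1.le
      (fun i => (min_le_left _ _).trans (hc₁' i)) hδ (hodd (s + 1) (by omega))
  have evenState : ∀ s : ℕ, IsScaled μ ν κ K (E * (1 - δ) ^ (2 * s)) (π (2 * (s + 1))) := by
    intro s
    induction s with
    | zero => simpa using hS
    | succ s ih =>
      have h := (rowStep s ih).rowRescale hν hμ hμsum hκ.le hK (hEρ _) hδ0.le hδ1.le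
        (fun j => (min_le_right _ _).trans (hc₂' j)) hδ (B := (π (2 * (s + 1 + 1))).transpose)
        (fun j i => heven (s + 1 + 1) (by omega) i j)
      rwa [mul_assoc, ← pow_succ, Matrix.transpose_transpose] at h
  obtain ⟨D, hD⟩ := exists_forall_sq_mul_pow_le hρ0.le (sub_lt_self 1 hδ0)
  have hD0 : 0 ≤ D := by simpa using hD 0
  set F : ℕ → ℝ := fun t => (∑ i, μt t i * Real.log (μt t i / μ i))
          + (∑ i, μ i * Real.log (μ i / μt t i))
          + (∑ j, νt t j * Real.log (νt t j / ν j))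
          + (∑ j, ν j * Real.log (ν j / νt t j)) with hF
  have hbound : ∀ k : ℕ, F (k + 2) ≤ E * (1 - δ) ^ k * (K ^ 2 + K) := by
    intro k
    simp only [hF, hμt, hνt]
    obtain ⟨s, rfl | rfl⟩ := Nat.even_or_odd' k
    · have h := evenState s
      have e1 := h.symm_kl_le hμ hμsum hνsum hK (hEρ _)
      have e2 := h.sum_col_log_eq_zero hν
      rw [mul_add] at e1 e2
      linarith
    · have h := rowStep s (evenState s)
      have e1 := h.symm_kl_le hν hνsum hμsum hK (hEρ _)
      have e2 := h.sum_col_log_eq_zero hμ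
      simp only [Matrix.transpose_apply] at e1 e2
      have e3 : 2 * s + 1 + 2 = 2 * (s + 1) + 1 := by ring
      rw [e3]
      linarith
  have hG : 0 ≤ E * (K ^ 2 + K) * ((1 - δ) ^ 2)⁻¹ := by positivity
  refine ⟨|F 1| + E * (K ^ 2 + K) * ((1 - δ) ^ 2)⁻¹ * D + 1, by positivity, fun t ht => ?_⟩
  change F t ≤ _
  rw [le_div_iff₀ (by positivity)]
  have hGD := mul_nonneg hG hD0
  obtain rfl | ht2 := ht.eq_or_lt
  · have := le_abs_self (F 1)
    norm_num
    linarith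
  · obtain ⟨k, rfl⟩ := Nat.exists_eq_add_of_le' ht2
    calc F (k + 2) * ((k + 2 : ℕ) : ℝ) ^ 2
        ≤ E * (1 - δ) ^ k * (K ^ 2 + K) * ((k + 2 : ℕ) : ℝ) ^ 2 :=
          mul_le_mul_of_nonneg_right (hbound k) (by positivity)
      _ = E * (K ^ 2 + K) * ((1 - δ) ^ 2)⁻¹ *
            (((k + 2 : ℕ) : ℝ) ^ 2 * (1 - δ) ^ (k + 2)) := by
          rw [pow_add]
          have := hρ0.ne'
          field_simp
      _ ≤ E * (K ^ 2 + K) * ((1 - δ) ^ 2)⁻¹ * D := mul_le_mul_of_nonneg_left (hD _) hG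
      _ ≤ _ := by linarith [abs_nonneg (F 1)]
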